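/- A single stiff fluid admits no shocks: assume both phases obey the same stiff pressure law, p_I = q + μ_I and p_II = q + μ_II for one and the same constant q ∈ ℝ, together with the positivity conditions μ_I + p_I > 0, μ_II + p_II > 0, μ_I + p_II > 0, μ_II + p_I > 0. If the Rankine–Hugoniot relation holds and W_I ≠ Z, then the two states coincide: μ_II = μ_I, W_II = W_I and u∥_II = u∥_I. Hence a single stiff fluid admits no shock waves, only contact interfaces propagating at the light speed. -/

import Mathlib

open Real

/-- Squared Euclidean norm of a vector. -/
noncomputable def nsq {n : ℕ} (w : Fin n → ℝ) : ℝ := ∑ j, (w j) ^ 2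

/-- Minkowski bilinear form on `ℝ^{d+1}`: `η(x,y) = -x₀y₀ + ∑_{j=1}^d xⱼyⱼ`. -/
noncomputable def eta {d : ℕ} (x y : Fin (d + 1) → ℝ) : ℝ :=
  -(x 0 * y 0) + ∑ j : Fin d, x j.succ * y j.succ

/-- Unit spacelike normal `V = (sinh Z, cosh Z, 0, …, 0)` to the interface. -/
noncomputable def normalV (d : ℕ) (Z : ℝ) : Fin (d + 1) → ℝ := fun i =>
  if i.val = 0 then Real.sinh Z else if i.val = 1 then Real.cosh Z else 0

/-- Unit timelike fluid velocity determined by the perpendicular rapidity `W` and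
the parallel velocity `w ∈ ℝ^{d-1}`. -/
noncomputable def vel (d : ℕ) (W : ℝ) (w : Fin (d - 1) → ℝ) : Fin (d + 1) → ℝ := fun i =>
  if i.val = 0 then Real.sqrt (1 + nsq w) * Real.cosh W
  else if i.val = 1 then Real.sqrt (1 + nsq w) * Real.sinh W
  else if h : i.val - 2 < d - 1 then w ⟨i.val - 2, h⟩ else 0

/-- The Rankine–Hugoniot relation
`(μ_II + p_II) η(u_II,V) u_II − (μ_I + p_I) η(u_I,V) u_I + (p_II − p_I) V = 0`. -/
def RH (d : ℕ) (μI pI μII pII : ℝ) (uI uII V : Fin (d + 1) → ℝ) : Prop :=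
  ∀ i, (μII + pII) * eta uII V * uII i - (μI + pI) * eta uI V * uI i + (pII - pI) * V i = 0

theorem nsq_nonneg {n : ℕ} (w : Fin n → ℝ) : 0 ≤ nsq w :=
  Finset.sum_nonneg fun j _ => sq_nonneg (w j)

theorem nsq_smul {n : ℕ} (c : ℝ) (w : Fin n → ℝ) : nsq (fun j => c * w j) = c ^ 2 * nsq w := by
  simp only [nsq, mul_pow, Finset.mul_sum]

theorem eta_vel_normalV (d : ℕ) (hd : 2 ≤ d) (W Z : ℝ) (w : Fin (d - 1) → ℝ) :
    eta (vel d W w) (normalV d Z) = √(1 + nsq w) * sinh (W - Z) := by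
  obtain ⟨n, rfl⟩ : ∃ n, d = n + 1 := ⟨d - 1, by omega⟩
  rw [eta, Fin.sum_univ_succ, Finset.sum_eq_zero]
  · simp [vel, normalV, sinh_sub]
    ring
  · intro j _
    simp [normalV]

/-- The Rankine–Hugoniot relation split into its components along the normal, along the timelike
direction orthogonal to the normal within the plane of motion, and parallel to the interface. -/
theorem RH.components {d : ℕ} (hd : 2 ≤ d) {Z μI μII pI pII WI WII : ℝ}
    {wI wII : Fin (d - 1) → ℝ}
    (h : RH d μI pI μII pII (vel d WI wI) (vel d WII wII) (normalV d Z)) :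
    (μII + pII) * (√(1 + nsq wII) * sinh (WII - Z)) ^ 2
        - (μI + pI) * (√(1 + nsq wI) * sinh (WI - Z)) ^ 2 + (pII - pI) = 0 ∧
      (μII + pII) * (√(1 + nsq wII) * sinh (WII - Z)) * (√(1 + nsq wII) * cosh (WII - Z))
        = (μI + pI) * (√(1 + nsq wI) * sinh (WI - Z)) * (√(1 + nsq wI) * cosh (WI - Z)) ∧
      ∀ j, (μII + pII) * (√(1 + nsq wII) * sinh (WII - Z)) * wII j
        = (μI + pI) * (√(1 + nsq wI) * sinh (WI - Z)) * wI j := by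
  simp only [RH, eta_vel_normalV d hd] at h
  have time := h ⟨0, by omega⟩
  have space := h ⟨1, by omega⟩
  simp only [vel, normalV, if_true, one_ne_zero, if_false] at time space
  have unit := cosh_sq_sub_sinh_sq Z
  refine ⟨?_, ?_, fun j => ?_⟩
  · simp only [sinh_sub] at time space ⊢
    linear_combination cosh Z * space - sinh Z * time - (pII - pI) * unit
  · simp only [sinh_sub, cosh_sub] at time space ⊢
    linear_combination cosh Z * time - sinh Z * space
  · have hj := h ⟨j + 2, by omega⟩
    simp [vel, normalV] at hj
    linarith

/-- A single stiff fluid admits no shocks: with a common stiff pressure law on both sides,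
any non-characteristic Rankine–Hugoniot interface has coinciding states. -/
theorem stiff_fluid_no_shock (d : ℕ) (hd : 2 ≤ d) (Z μI μII pI pII q WI WII : ℝ)
    (wI wII : Fin (d - 1) → ℝ) (hμI : 0 ≤ μI) (hμII : 0 ≤ μII)
    (hpI : pI = q + μI) (hpII : pII = q + μII)
    (h1 : 0 < μI + pI) (h2 : 0 < μII + pII) (h3 : 0 < μI + pII) (h4 : 0 < μII + pI)
    (hRH : RH d μI pI μII pII (vel d WI wI) (vel d WII wII) (normalV d Z))
    (hW : WI ≠ Z) :
    μII = μI ∧ WII = WI ∧ wII = wI := by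
  obtain ⟨normal, time, parallel⟩ := hRH.components hd
  have γ_pos {n : ℕ} (w : Fin n → ℝ) : 0 < √(1 + nsq w) := by
    have := nsq_nonneg w
    positivity
  have mass_shell {n : ℕ} (W : ℝ) (w : Fin n → ℝ) :
      (√(1 + nsq w) * cosh (W - Z)) ^ 2 - nsq w = 1 + (√(1 + nsq w) * sinh (W - Z)) ^ 2 := by
    have hγ : √(1 + nsq w) ^ 2 = 1 + nsq w := sq_sqrt (by linarith [nsq_nonneg w])
    linear_combination √(1 + nsq w) ^ 2 * cosh_sq_sub_sinh_sq (W - Z) + hγ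
  have shellI := mass_shell WI wI
  have shellII := mass_shell WII wII
  have cI : 0 < √(1 + nsq wI) * cosh (WI - Z) := mul_pos (γ_pos _) (cosh_pos _)
  have cII : 0 < √(1 + nsq wII) * cosh (WII - Z) := mul_pos (γ_pos _) (cosh_pos _)
  have xI_ne : √(1 + nsq wI) * sinh (WI - Z) ≠ 0 :=
    mul_ne_zero (γ_pos _).ne' (by rwa [Ne, sinh_eq_zero, sub_eq_zero])
  have finish : √(1 + nsq wII) * sinh (WII - Z) = √(1 + nsq wI) * sinh (WI - Z) →
      wII = wI → WII = WI := by
    rintro hx rfl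
    linarith [sinh_injective (mul_left_cancel₀ (γ_pos _).ne' hx)]
  have parallel_sq := congrArg nsq (funext parallel)
  simp only [nsq_smul] at parallel_sq
  generalize √(1 + nsq wI) * sinh (WI - Z) = xI at *
  generalize √(1 + nsq wII) * sinh (WII - Z) = xII at *
  generalize √(1 + nsq wI) * cosh (WI - Z) = yI at *
  generalize √(1 + nsq wII) * cosh (WII - Z) = yII at *
  subst hpI hpII
  have quartic : ((μII + (q + μII)) * xII) ^ 2 * (1 + xII ^ 2)
      = ((μI + (q + μI)) * xI) ^ 2 * (1 + xI ^ 2) := by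
    rw [← shellI, ← shellII]
    linear_combination ((μII + (q + μII)) * xII * yII + (μI + (q + μI)) * xI * yI) * time
      - parallel_sq
  have enthalpy_sq : (μII + (q + μII)) ^ 2 = (μI + (q + μI)) ^ 2 := by
    have : (μII + (q + μII)) * (2 * xII ^ 2 + 1) = (μI + (q + μI)) * (2 * xI ^ 2 + 1) := by
      linear_combination 2 * normal
    linear_combination ((μII + (q + μII)) * (2 * xII ^ 2 + 1)
      + (μI + (q + μI)) * (2 * xI ^ 2 + 1)) * this - 4 * quartic
  obtain rfl : μII = μI := by linarith [(sq_eq_sq₀ h2.le h1.le).1 enthalpy_sq]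
  have x_sq : xII ^ 2 = xI ^ 2 := mul_left_cancel₀ h1.ne' (by linarith)
  have hx : xII = xI := by
    refine (sq_eq_sq_iff_eq_or_eq_neg.1 x_sq).resolve_right ?_
    rintro rfl
    have : (μII + (q + μII)) * (yI + yII) * xI = 0 := by linear_combination -time
    exact xI_ne ((mul_eq_zero.1 this).resolve_left (by positivity))
  subst hx
  have hw : wII = wI := funext fun j => mul_left_cancel₀ (mul_ne_zero h1.ne' xI_ne) (parallel j)
  exact ⟨rfl, finish rfl hw, hw⟩
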